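/- arXiv:1607.06163 — 7 statements merged into one kernel-verified Lean document; each statement's English description precedes it below -/
import Mathlib

section
/- Let J be a d×d real symmetric positive definite matrix with positive definite square root J^{1/2}, s ∈ ℝ^d, G a c×d real matrix such that G J⁻¹ Gᵀ is invertible, and g₀ ∈ ℝ^c. Suppose u ∈ ℝ^d and λ ∈ ℝ^c satisfy the Lagrangian first-order condition s − J u + Gᵀλ = 0 and the binding-constraint equation G u + g₀ = 0. Set X = J^{−1/2} Gᵀ (so XᵀX = G J⁻¹ Gᵀ is invertible), Y = J^{−1/2} s, P_X = X(XᵀX)⁻¹Xᵀ and M_X = I_d − P_X. Then J^{1/2} u = M_X Y − X(XᵀX)⁻¹ g₀ and X λ = −P_X Y − X(XᵀX)⁻¹ g₀. -/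
open Matrix

/-- If `v = y + X l` and `Xᵀ v = -g` with `XᵀX` invertible, then
`X l = -(X (XᵀX)⁻¹ Xᵀ) y - X (XᵀX)⁻¹ g`. -/
theorem Matrix.mulVec_eq_neg_proj_sub {m n R : Type*} [Fintype m] [Fintype n] [DecidableEq n]
    [CommRing R] {X : Matrix m n R} (hX : IsUnit (Xᵀ * X)) {y v : m → R} {l g : n → R}
    (hv : v = y + X *ᵥ l) (hg : Xᵀ *ᵥ v = -g) :
    X *ᵥ l = -((X * (Xᵀ * X)⁻¹ * Xᵀ) *ᵥ y) - (X * (Xᵀ * X)⁻¹) *ᵥ g := by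
  have hl : (X * (Xᵀ * X)⁻¹) *ᵥ ((Xᵀ * X) *ᵥ l) = X *ᵥ l := by
    rw [mulVec_mulVec, Matrix.mul_assoc, nonsing_inv_mul _ ((isUnit_iff_isUnit_det _).mp hX),
      Matrix.mul_one]
  have hnormal : (Xᵀ * X) *ᵥ l = -(Xᵀ *ᵥ y) - g := by
    rw [hv, mulVec_add, mulVec_mulVec] at hg
    linear_combination hg
  rw [← hl, hnormal, mulVec_sub, mulVec_neg, mulVec_mulVec]

/-- Lemma 1 of the paper, quadratic/linear case. If `u`, `λ` satisfy the
Lagrangian first-order condition `s − J u + Gᵀλ = 0` and the binding constraints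
`G u + g₀ = 0`, then with `X = J^{−1/2} Gᵀ`, `Y = J^{−1/2} s`, `P_X = X(XᵀX)⁻¹Xᵀ`,
`M_X = I − P_X`, we have `J^{1/2} u = M_X Y − X(XᵀX)⁻¹ g₀` and
`X λ = −P_X Y − X(XᵀX)⁻¹ g₀`. -/
theorem stmt1 {d c : ℕ} (J Jhalf : Matrix (Fin d) (Fin d) ℝ)
    (hJ : J.PosDef) (hJhalf : Jhalf.PosDef) (hsq : Jhalf * Jhalf = J)
    (s : Fin d → ℝ) (G : Matrix (Fin c) (Fin d) ℝ)
    (hG : IsUnit (G * J⁻¹ * Gᵀ)) (g₀ : Fin c → ℝ)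
    (u : Fin d → ℝ) (lam : Fin c → ℝ)
    (hFOC : s - J.mulVec u + Gᵀ.mulVec lam = 0)
    (hbind : G.mulVec u + g₀ = 0) :
    let X : Matrix (Fin d) (Fin c) ℝ := Jhalf⁻¹ * Gᵀ
    let Y : Fin d → ℝ := Jhalf⁻¹.mulVec s
    let PX : Matrix (Fin d) (Fin d) ℝ := X * (Xᵀ * X)⁻¹ * Xᵀ
    let MX : Matrix (Fin d) (Fin d) ℝ := 1 - PX
    Xᵀ * X = G * J⁻¹ * Gᵀ ∧ IsUnit (Xᵀ * X) ∧
    Jhalf.mulVec u = MX.mulVec Y - (X * (Xᵀ * X)⁻¹).mulVec g₀ ∧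
    X.mulVec lam = -(PX.mulVec Y) - (X * (Xᵀ * X)⁻¹).mulVec g₀ := by
  intro X Y PX MX
  have hdet : IsUnit Jhalf.det := (isUnit_iff_isUnit_det _).mp hJhalf.isUnit
  have hXT : Xᵀ = G * Jhalf⁻¹ := by
    have hsymm : Jhalfᵀ = Jhalf := by simpa using hJhalf.isHermitian.eq
    simp only [X, transpose_mul, transpose_transpose, transpose_nonsing_inv, hsymm]
  have hXX : Xᵀ * X = G * J⁻¹ * Gᵀ := by
    rw [hXT, ← hsq, Matrix.mul_inv_rev]
    simp only [X, Matrix.mul_assoc]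
  have hunit : IsUnit (Xᵀ * X) := hXX ▸ hG
  have hv : Jhalf *ᵥ u = Y + X *ᵥ lam := by
    have h := congrArg (Jhalf⁻¹ *ᵥ ·) hFOC
    simp only [mulVec_add, mulVec_sub, mulVec_mulVec, mulVec_zero, ← hsq,
      nonsing_inv_mul_cancel_left _ _ hdet] at h
    linear_combination -h
  have hg : Xᵀ *ᵥ (Jhalf *ᵥ u) = -g₀ := by
    rw [hXT, mulVec_mulVec, nonsing_inv_mul_cancel_right _ _ hdet]
    exact eq_neg_of_add_eq_zero_left hbind
  have hlam := mulVec_eq_neg_proj_sub hunit hv hg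
  refine ⟨hXX, hunit, ?_, hlam⟩
  rw [hv, hlam, sub_mulVec, one_mulVec]
  abel
end

section
/- Let (Ω,ℱ,P) be a probability space, d ≥ 1, and for each T ∈ ℕ let Q_T : Ω × ℝ^d → ℝ be such that Q_T(ω,·) is twice continuously differentiable for every ω and the gradient ∇Q_T(·,β) and Hessian ∇²Q_T(·,β) are measurable in ω; let β̂ʳ_T : Ω → ℝ^d be measurable and β⁰_T ∈ ℝ^d deterministic. Assume: (i) the sequence √T ∇Q_T(·,β⁰_T) is bounded in probability; (ii) there exists a symmetric positive definite d×d matrix J⁰ such that for every γ > 0, sup over the ball {β : ‖β − β⁰_T‖ ≤ γ/√T} of ‖∇²Q_T(·,β) + J⁰‖ converges to 0 in probability; (iii) √T(β̂ʳ_T − β⁰_T) is bounded in probability. Define the FUNC estimator β̂_T := β̂ʳ_T − [∇²Q_T(·, β̂ʳ_T)]⁻¹ ∇Q_T(·, β̂ʳ_T) and the infeasible unconstrained estimator β̈_T := β⁰_T + [−∇²Q_T(·, β⁰_T)]⁻¹ ∇Q_T(·, β⁰_T) (using the matrix inverse when it exists and any fixed convention otherwise). Then √T(β̂_T − β̈_T)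 converges to 0 in probability. -/
open MeasureTheory Filter Matrix

attribute [local instance] Matrix.normedAddCommGroup

/-- The gradient of `f : ℝ^d → ℝ` at `x`, as a vector of partial derivatives. -/
noncomputable def gradOf {d : ℕ} (f : (Fin d → ℝ) → ℝ) (x : Fin d → ℝ) : Fin d → ℝ :=
  fun i => fderiv ℝ f x (Pi.single i 1)

/-- The Hessian matrix of `f : ℝ^d → ℝ` at `x`. -/
noncomputable def hessOf {d : ℕ} (f : (Fin d → ℝ) → ℝ) (x : Fin d → ℝ) :
    Matrix (Fin d) (Fin d) ℝ :=
  Matrix.of fun i j =>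
    fderiv ℝ (fun y => fderiv ℝ f y (Pi.single j 1)) x (Pi.single i 1)

/-- A sequence of random vectors is bounded in probability: for every `ε > 0` there is
`M > 0` with `P(‖Z_T‖ > M) < ε` for all `T`. -/
def BoundedInProb {Ω E : Type*} [MeasurableSpace Ω] [Norm E]
    (P : Measure Ω) (Z : ℕ → Ω → E) : Prop :=
  ∀ ε : ℝ, 0 < ε → ∃ M : ℝ, 0 < M ∧ ∀ T : ℕ, P {ω | M < ‖Z T ω‖} < ENNReal.ofReal ε

/-- A sequence of random vectors converges to `0` in probability:
`P(‖Z_T‖ > ε) → 0` for every `ε > 0`. -/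
def TendstoInProbZero {Ω E : Type*} [MeasurableSpace Ω] [Norm E]
    (P : Measure Ω) (Z : ℕ → Ω → E) : Prop :=
  ∀ ε : ℝ, 0 < ε → Tendsto (fun T : ℕ => P {ω | ε < ‖Z T ω‖}) atTop (nhds 0)

lemma norm_mulVec_le_card_mul {d : ℕ} (A : Matrix (Fin d) (Fin d) ℝ) (v : Fin d → ℝ) :
    ‖A.mulVec v‖ ≤ d * ‖A‖ * ‖v‖ := by
  refine (pi_norm_le_iff_of_nonneg (by positivity)).2 fun i => ?_
  calc ‖A.mulVec v i‖ ≤ ∑ j, ‖A i j * v j‖ := by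
        simp only [Matrix.mulVec, dotProduct]
        exact norm_sum_le _ _
    _ ≤ ∑ _j : Fin d, ‖A‖ * ‖v‖ := by
        refine Finset.sum_le_sum fun j _ => ?_
        rw [norm_mul]
        gcongr
        · exact norm_entry_le_entrywise_sup_norm A
        · exact norm_le_pi_norm v j
    _ = d * ‖A‖ * ‖v‖ := by simp [mul_assoc]

/-- A real linear map on `ℝ^d` evaluated through its values on the standard basis. -/
lemma clm_apply_eq_sum_single {d : ℕ} (L : (Fin d → ℝ) →L[ℝ] ℝ) (v : Fin d → ℝ) :
    L v = ∑ i, v i * L (Pi.single i 1) := by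
  conv_lhs => rw [pi_eq_sum_univ' v]
  simp [map_sum, Pi.single]

/-- First-order expansion of the gradient, when the Hessian is within `δ` of `-J` on a ball. -/
lemma norm_gradOf_sub_add_mulVec_le {d : ℕ} {f : (Fin d → ℝ) → ℝ} (hf : ContDiff ℝ 2 f)
    {J : Matrix (Fin d) (Fin d) ℝ} (hJ : J.IsHermitian) {b x : Fin d → ℝ} {r δ : ℝ}
    (hδ : 0 ≤ δ) (hx : ‖x - b‖ ≤ r) (hH : ∀ y, ‖y - b‖ ≤ r → ‖hessOf f y + J‖ ≤ δ) :
    ‖gradOf f x - gradOf f b + J.mulVec (x - b)‖ ≤ d * δ * ‖x - b‖ := by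
  refine (pi_norm_le_iff_of_nonneg (by positivity)).2 fun j => ?_
  have hr : 0 ≤ r := (norm_nonneg _).trans hx
  let R : (Fin d → ℝ) →L[ℝ] ℝ := (LinearMap.proj j ∘ₗ J.mulVecLin).toContinuousLinearMap
  have hR : ∀ v, R v = J.mulVec v j := fun v => rfl
  have hdf : Differentiable ℝ fun y => fderiv ℝ f y (Pi.single j 1) :=
    ((hf.fderiv_right (m := 1) (by norm_num)).differentiable (by norm_num)).clm_apply
      (differentiable_const _)
  have hderiv : ∀ y ∈ Metric.closedBall b r,
      HasFDerivWithinAt (fun y => fderiv ℝ f y (Pi.single j 1) + R y)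
        (fderiv ℝ (fun y => fderiv ℝ f y (Pi.single j 1)) y + R) (Metric.closedBall b r) y :=
    fun y _ => ((hdf y).hasFDerivAt.add R.hasFDerivAt).hasFDerivWithinAt
  have hbound : ∀ y ∈ Metric.closedBall b r,
      ‖fderiv ℝ (fun y => fderiv ℝ f y (Pi.single j 1)) y + R‖ ≤ d * δ := by
    intro y hy
    rw [Metric.mem_closedBall, dist_eq_norm] at hy
    refine ContinuousLinearMap.opNorm_le_bound _ (by positivity) fun v => ?_
    rw [clm_apply_eq_sum_single]
    calc ‖∑ i, v i * (fderiv ℝ (fun y => fderiv ℝ f y (Pi.single j 1)) y + R) (Pi.single i 1)‖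
        ≤ ∑ i, ‖v i * (hessOf f y + J) i j‖ := by
          refine (norm_sum_le _ _).trans_eq (Finset.sum_congr rfl fun i _ => ?_)
          have hsymm : J j i = J i j := by simpa using hJ.apply i j
          simp [hR, hessOf, hsymm]
      _ ≤ ∑ _i : Fin d, ‖v‖ * δ := by
          refine Finset.sum_le_sum fun i _ => ?_
          rw [norm_mul]
          gcongr
          · exact norm_le_pi_norm v i
          · exact (norm_entry_le_entrywise_sup_norm _).trans (hH y hy)
      _ = d * δ * ‖v‖ := by simp; ring
  have hmv := (convex_closedBall b r).norm_image_sub_le_of_norm_hasFDerivWithin_le hderiv hbound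
    (Metric.mem_closedBall_self hr) (by simpa [dist_eq_norm] using hx : x ∈ _)
  have heq : (gradOf f x - gradOf f b + J.mulVec (x - b)) j =
      fderiv ℝ f x (Pi.single j 1) + R x - (fderiv ℝ f b (Pi.single j 1) + R b) := by
    simp only [Pi.add_apply, Pi.sub_apply, gradOf, ← hR, map_sub]
    ring
  rwa [heq]

lemma Matrix.continuousAt_inv_of_det_ne_zero {d : ℕ} {J : Matrix (Fin d) (Fin d) ℝ}
    (hJ : J.det ≠ 0) : ContinuousAt (fun A : Matrix (Fin d) (Fin d) ℝ => A⁻¹) J := by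
  have h : (fun A : Matrix (Fin d) (Fin d) ℝ => A⁻¹) = fun A => A.det⁻¹ • A.adjugate := by
    ext1 A
    rw [Matrix.inv_def, Ring.inverse_eq_inv']
  rw [h]
  exact ((continuous_id.matrix_det.continuousAt).inv₀ hJ).smul
    continuous_id.matrix_adjugate.continuousAt

/-- Near an invertible matrix, matrices are invertible with inverses uniformly close. -/
lemma Matrix.exists_forall_norm_sub_le_inv {d : ℕ} {J : Matrix (Fin d) (Fin d) ℝ}
    (hJ : J.det ≠ 0) {η : ℝ} (hη : 0 < η) :
    ∃ δ > 0, ∀ A : Matrix (Fin d) (Fin d) ℝ, ‖A - J‖ ≤ δ → A.det ≠ 0 ∧ ‖A⁻¹ - J⁻¹‖ ≤ η := by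
  have hdet : ∀ᶠ A : Matrix (Fin d) (Fin d) ℝ in nhds J, A.det ≠ 0 :=
    continuous_id.matrix_det.continuousAt.eventually_ne hJ
  have hinv : ∀ᶠ A : Matrix (Fin d) (Fin d) ℝ in nhds J, A⁻¹ ∈ Metric.closedBall J⁻¹ η :=
    Matrix.continuousAt_inv_of_det_ne_zero hJ (Metric.closedBall_mem_nhds _ hη)
  obtain ⟨δ, hδ, h⟩ := Metric.nhds_basis_closedBall.eventually_iff.1 (hdet.and hinv)
  refine ⟨δ, hδ, fun A hA => ?_⟩
  have := h (by simpa [dist_eq_norm] using hA : A ∈ Metric.closedBall J δ)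
  simpa [dist_eq_norm] using this

/-- The scaled Newton-step difference in terms of the linearisation errors. -/
lemma newton_sub_eq {d : ℕ} {H H0 J : Matrix (Fin d) (Fin d) ℝ} (hH : (-H).det ≠ 0)
    (s : ℝ) (x b g g0 : Fin d → ℝ) :
    s • ((x - H⁻¹.mulVec g) - (b + (-H0)⁻¹.mulVec g0)) =
      (-H)⁻¹.mulVec ((-H - J).mulVec (s • (x - b))) +
        (-H)⁻¹.mulVec (s • (g - g0 + J.mulVec (x - b))) +
          ((-H)⁻¹ - (-H0)⁻¹).mulVec (s • g0) := by
  have hinv : H⁻¹ = -(-H)⁻¹ := by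
    have hu : IsUnit (-H).det := isUnit_iff_ne_zero.2 hH
    refine Matrix.inv_eq_left_inv ?_
    rw [neg_mul, ← mul_neg, Matrix.nonsing_inv_mul _ hu]
  have hcancel : ∀ v, (-H)⁻¹.mulVec ((-H).mulVec v) = v := fun v => by
    rw [Matrix.mulVec_mulVec, Matrix.nonsing_inv_mul _ (isUnit_iff_ne_zero.2 hH),
      Matrix.one_mulVec]
  rw [Matrix.sub_mulVec (-H), Matrix.mulVec_sub, hcancel, hinv]
  simp only [Matrix.sub_mulVec, Matrix.mulVec_add, Matrix.mulVec_sub, Matrix.mulVec_smul,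
    Matrix.neg_mulVec]
  module

/-- Deterministic core: if the scaled gradient and the scaled deviation are bounded by `M` and the
Hessian is close enough to `-J` on the ball of radius `M / s`, the scaled difference of the two
Newton steps is at most `ε`. -/
lemma exists_delta_newton_sub_le {d : ℕ} {J : Matrix (Fin d) (Fin d) ℝ} (hJ : J.PosDef)
    {M ε : ℝ} (hM : 0 < M) (hε : 0 < ε) :
    ∃ δ > 0, ∀ (f : (Fin d → ℝ) → ℝ), ContDiff ℝ 2 f → ∀ (s : ℝ) (b x : Fin d → ℝ), 0 < s →
      ‖s • gradOf f b‖ ≤ M → ‖s • (x - b)‖ ≤ M →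
      (∀ y, ‖y - b‖ ≤ M / s → ‖hessOf f y + J‖ ≤ δ) →
      ‖s • ((x - (hessOf f x)⁻¹.mulVec (gradOf f x)) -
        (b + (-(hessOf f b))⁻¹.mulVec (gradOf f b)))‖ ≤ ε := by
  set K : ℝ := ‖J⁻¹‖ + 1 with hK
  have hK0 : 0 < K := by positivity
  set D : ℝ := d + 1 with hD
  have hD0 : 0 < D := by positivity
  have hdD : (d : ℝ) ≤ D := by simp [hD]
  obtain ⟨δ₁, hδ₁, hinv⟩ := Matrix.exists_forall_norm_sub_le_inv hJ.det_pos.ne'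
    (η := min 1 (ε / (4 * D * M))) (by positivity)
  refine ⟨min δ₁ (ε / (4 * D * K * D * M)), by positivity, ?_⟩
  intro f hf s b x hs hg hu hH
  set δ := min δ₁ (ε / (4 * D * K * D * M)) with hδ
  have hδ0 : 0 < δ := by positivity
  have hx : ‖x - b‖ ≤ M / s := by
    rw [norm_smul, Real.norm_of_nonneg hs.le] at hu
    rwa [le_div_iff₀' hs]
  have hclose : ∀ y, ‖y - b‖ ≤ M / s → ‖-hessOf f y - J‖ ≤ δ := fun y hy => by
    rw [← neg_add', norm_neg]
    exact hH y hy
  have hA := hclose x hx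
  obtain ⟨hdet, hAinv⟩ := hinv _ (hA.trans (min_le_left _ _))
  obtain ⟨-, hBinv⟩ := hinv _ ((hclose b (by simp; positivity)).trans (min_le_left _ _))
  have hAK : ‖(-hessOf f x)⁻¹‖ ≤ K := by
    have := norm_le_norm_add_norm_sub' (-hessOf f x)⁻¹ J⁻¹
    linarith [hAinv.trans (min_le_left _ _)]
  have hdiff : ‖(-hessOf f x)⁻¹ - (-hessOf f b)⁻¹‖ ≤ 2 * (ε / (4 * D * M)) := by
    have := norm_sub_le_norm_sub_add_norm_sub (-hessOf f x)⁻¹ J⁻¹ (-hessOf f b)⁻¹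
    rw [norm_sub_rev J⁻¹] at this
    linarith [hAinv.trans (min_le_right _ _), hBinv.trans (min_le_right _ _)]
  have hrem : ‖s • (gradOf f x - gradOf f b + J.mulVec (x - b))‖ ≤ D * δ * M := by
    calc _ = s * ‖gradOf f x - gradOf f b + J.mulVec (x - b)‖ := by
          rw [norm_smul, Real.norm_of_nonneg hs.le]
      _ ≤ s * (d * δ * ‖x - b‖) := by
          gcongr
          exact norm_gradOf_sub_add_mulVec_le hf hJ.1 hδ0.le hx hH
      _ = d * δ * ‖s • (x - b)‖ := by
          rw [norm_smul, Real.norm_of_nonneg hs.le]; ring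
      _ ≤ D * δ * M := by gcongr
  have hlin : ‖(-hessOf f x - J).mulVec (s • (x - b))‖ ≤ D * δ * M :=
    (norm_mulVec_le_card_mul _ _).trans (by gcongr)
  have hsmall : D * K * (D * δ * M) ≤ ε / 4 := by
    calc D * K * (D * δ * M) ≤ D * K * (D * (ε / (4 * D * K * D * M)) * M) := by
          gcongr
          exact min_le_right _ _
      _ = ε / 4 := by field_simp
  rw [newton_sub_eq (J := J) hdet]
  refine (norm_add₃_le).trans ?_
  have h₁ : ‖(-hessOf f x)⁻¹.mulVec ((-hessOf f x - J).mulVec (s • (x - b)))‖ ≤ ε / 4 :=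
    ((norm_mulVec_le_card_mul _ _).trans (by gcongr)).trans hsmall
  have h₂ : ‖(-hessOf f x)⁻¹.mulVec (s • (gradOf f x - gradOf f b + J.mulVec (x - b)))‖
      ≤ ε / 4 :=
    ((norm_mulVec_le_card_mul _ _).trans (by gcongr)).trans hsmall
  have h₃ : ‖((-hessOf f x)⁻¹ - (-hessOf f b)⁻¹).mulVec (s • gradOf f b)‖ ≤ ε / 2 := by
    calc _ ≤ D * (2 * (ε / (4 * D * M))) * M :=
          (norm_mulVec_le_card_mul _ _).trans (by gcongr)
      _ = ε / 2 := by field_simp; norm_num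
  linarith

/-- Theorem 1 of the paper. Under (i) `√T ∇Q_T(β⁰_T)` bounded in
probability, (ii) uniform convergence in probability of the Hessian to `−J⁰` on
`1/√T`-balls around `β⁰_T`, and (iii) `√T(β̂ʳ_T − β⁰_T)` bounded in probability, the
FUNC estimator `β̂_T = β̂ʳ_T − [∇²Q_T(β̂ʳ_T)]⁻¹ ∇Q_T(β̂ʳ_T)` satisfies
`√T(β̂_T − β̈_T) → 0` in probability, where
`β̈_T = β⁰_T + [−∇²Q_T(β⁰_T)]⁻¹ ∇Q_T(β⁰_T)` is the infeasible unconstrained estimator. -/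
theorem stmt4 {Ω : Type*} [MeasurableSpace Ω] (P : Measure Ω) [IsProbabilityMeasure P]
    {d : ℕ} (hd : 1 ≤ d)
    (Q : ℕ → Ω → (Fin d → ℝ) → ℝ)
    (hC2 : ∀ T ω, ContDiff ℝ 2 (Q T ω))
    (hmeas_grad : ∀ T (β : Fin d → ℝ), Measurable fun ω => gradOf (Q T ω) β)
    (hmeas_hess : ∀ T (β : Fin d → ℝ) i j, Measurable fun ω => hessOf (Q T ω) β i j)
    (βr : ℕ → Ω → Fin d → ℝ) (hβr : ∀ T, Measurable (βr T))
    (β0 : ℕ → Fin d → ℝ)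
    (J0 : Matrix (Fin d) (Fin d) ℝ) (hJ0 : J0.PosDef)
    (hi : BoundedInProb P fun T ω => Real.sqrt T • gradOf (Q T ω) (β0 T))
    (hii : ∀ γ : ℝ, 0 < γ → ∀ ε : ℝ, 0 < ε →
      Tendsto (fun T : ℕ => P {ω | ∃ β : Fin d → ℝ,
          ‖β - β0 T‖ ≤ γ / Real.sqrt T ∧ ε < ‖hessOf (Q T ω) β + J0‖})
        atTop (nhds 0))
    (hiii : BoundedInProb P fun T ω => Real.sqrt T • (βr T ω - β0 T)) :
    TendstoInProbZero P fun T ω =>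
      Real.sqrt T •
        ((βr T ω - (hessOf (Q T ω) (βr T ω))⁻¹.mulVec (gradOf (Q T ω) (βr T ω))) -
          (β0 T + (-(hessOf (Q T ω) (β0 T)))⁻¹.mulVec (gradOf (Q T ω) (β0 T)))) := by
  intro ε hε
  rw [ENNReal.tendsto_nhds_zero]
  intro c hc
  obtain ⟨c', hc'0, hc'⟩ : ∃ c' : ℝ, 0 < c' ∧ 3 * ENNReal.ofReal c' ≤ c := by
    rcases eq_or_ne c ⊤ with rfl | hct
    · exact ⟨1, one_pos, le_top⟩
    · have hc0 : 0 < c.toReal := ENNReal.toReal_pos hc.ne' hct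
      refine ⟨c.toReal / 3, by positivity, le_of_eq ?_⟩
      rw [← ENNReal.ofReal_ofNat 3, ← ENNReal.ofReal_mul (by norm_num),
        mul_div_cancel₀ _ (by norm_num), ENNReal.ofReal_toReal hct]
  obtain ⟨M₁, hM₁, hP₁⟩ := hi c' hc'0
  obtain ⟨M₂, hM₂, hP₂⟩ := hiii c' hc'0
  have hM : 0 < max M₁ M₂ := lt_max_of_lt_left hM₁
  obtain ⟨δ, hδ, hcore⟩ := exists_delta_newton_sub_le hJ0 hM hε
  filter_upwards [ENNReal.tendsto_nhds_zero.1 (hii _ hM δ hδ) _ (ENNReal.ofReal_pos.2 hc'0),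
    eventually_gt_atTop 0] with T hT hT0
  have hs : 0 < Real.sqrt T := Real.sqrt_pos.2 (by exact_mod_cast hT0)
  refine le_trans (measure_mono (t := ({ω | M₁ < ‖Real.sqrt T • gradOf (Q T ω) (β0 T)‖} ∪
    {ω | M₂ < ‖Real.sqrt T • (βr T ω - β0 T)‖}) ∪ {ω | ∃ β : Fin d → ℝ,
      ‖β - β0 T‖ ≤ max M₁ M₂ / Real.sqrt T ∧ δ < ‖hessOf (Q T ω) β + J0‖}) ?_) ?_
  · intro ω hω
    by_contra hnot
    simp only [Set.mem_union, Set.mem_ofPred_eq, not_or, not_lt, not_exists, not_and] at hnot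
    obtain ⟨⟨hg, hu⟩, hH⟩ := hnot
    exact (hcore (Q T ω) (hC2 T ω) _ _ _ hs (hg.trans (le_max_left _ _))
      (hu.trans (le_max_right _ _)) hH).not_gt hω
  · calc _ ≤ ENNReal.ofReal c' + ENNReal.ofReal c' + ENNReal.ofReal c' :=
          (measure_union_le _ _).trans
            (add_le_add ((measure_union_le _ _).trans (add_le_add (hP₁ T).le (hP₂ T).le)) hT)
      _ = 3 * ENNReal.ofReal c' := by ring
      _ ≤ c := hc'
end

section
/- Let Θ be a set, d ≥ 1, H : Θ → (d×d real matrices) with H(θ) invertible for every θ ∈ Θ, s : Θ → ℝ^d, and β̂ʳ, β̂ ∈ ℝ^d. Define the score-matching moment m(θ) := s(θ) + H(θ)(β̂ − β̂ʳ) and the simulated auxiliary map β̃ᶜ(θ) := β̂ʳ − H(θ)⁻¹ s(θ). Then m(θ) = H(θ)(β̂ − β̃ᶜ(θ)) for all θ ∈ Θ; consequently m(θ) = 0 if and only if β̂ = β̃ᶜ(θ), and if θ̂ˢ ∈ Θ satisfies m(θ̂ˢ) = 0 and θ̂ᶜ ∈ Θ satisfies β̂ = β̃ᶜ(θ̂ᶜ),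 then β̃ᶜ(θ̂ˢ) = β̃ᶜ(θ̂ᶜ) = β̂. -/
open Matrix

/-- Theorem 3 of the paper. With `m(θ) = s(θ) + H(θ)(β̂ − β̂ʳ)` and
`β̃ᶜ(θ) = β̂ʳ − H(θ)⁻¹ s(θ)`, one has `m(θ) = H(θ)(β̂ − β̃ᶜ(θ))`; hence `m(θ) = 0` iff
`β̂ = β̃ᶜ(θ)`, and if `m(θ̂ˢ) = 0` and `β̂ = β̃ᶜ(θ̂ᶜ)` then
`β̃ᶜ(θ̂ˢ) = β̃ᶜ(θ̂ᶜ) = β̂`. -/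
theorem stmt6 {Θ : Type*} {d : ℕ}
    (H : Θ → Matrix (Fin d) (Fin d) ℝ) (hH : ∀ θ, IsUnit (H θ))
    (s : Θ → Fin d → ℝ) (βr βh : Fin d → ℝ) :
    let m : Θ → Fin d → ℝ := fun θ => s θ + (H θ).mulVec (βh - βr)
    let βc : Θ → Fin d → ℝ := fun θ => βr - (H θ)⁻¹.mulVec (s θ)
    (∀ θ, m θ = (H θ).mulVec (βh - βc θ)) ∧
    (∀ θ, m θ = 0 ↔ βh = βc θ) ∧
    (∀ θs θc : Θ, m θs = 0 → βh = βc θc → βc θs = βh ∧ βc θc = βh) := by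
  intro m βc
  have hm (θ : Θ) : m θ = (H θ).mulVec (βh - βc θ) := by
    have hdet := (Matrix.isUnit_iff_isUnit_det _).mp (hH θ)
    simp only [m, βc, Matrix.mulVec_sub, Matrix.mulVec_mulVec, Matrix.mul_nonsing_inv _ hdet,
      Matrix.one_mulVec]
    abel
  have hzero (θ : Θ) : m θ = 0 ↔ βh = βc θ := by
    rw [hm, ← sub_eq_zero (a := βh)]
    exact map_eq_zero_iff (H θ).mulVecLin (Matrix.mulVec_injective_of_isUnit (hH θ))
  exact ⟨hm, hzero, fun θs _ hs hc => ⟨((hzero θs).mp hs).symm, hc.symm⟩⟩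
end

section
/- Let V be a q×q real symmetric positive definite matrix, A a p×q real matrix of full row rank p, and Γ_θ a q×k real matrix. Then AVAᵀ is invertible and the matrix Γ_θᵀ V⁻¹ Γ_θ − Γ_θᵀ Aᵀ (A V Aᵀ)⁻¹ A Γ_θ is positive semidefinite. -/
open Matrix

/-- Congruence by a matrix of full row rank preserves positive definiteness. -/
theorem posDef_mul_mul_transpose_of_rank_eq {m n : Type*} [Fintype m] [Fintype n]
    {V : Matrix n n ℝ} (hV : V.PosDef) {A : Matrix m n ℝ} (hA : A.rank = Fintype.card m) :
    (A * V * Aᵀ).PosDef := by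
  have hrow : LinearIndependent ℝ A.row := by
    rw [linearIndependent_iff_card_eq_finrank_span, ← hA, rank_eq_finrank_span_row]
    rfl
  simpa only [conjTranspose_eq_transpose_of_trivial] using
    hV.mul_mul_conjTranspose_same (vecMul_injective_iff.2 hrow)

/-- For `A * V * Aᵀ` invertible, `Aᵀ (A V Aᵀ)⁻¹ A ≤ V⁻¹` in the Loewner order. -/
theorem posSemidef_inv_sub_transpose_mul_inv_mul {m n : Type*} [Fintype m] [Fintype n]
    [DecidableEq m] [DecidableEq n] {V : Matrix n n ℝ} (hV : V.PosDef) {A : Matrix m n ℝ}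
    (hS : IsUnit (A * V * Aᵀ)) :
    (V⁻¹ - Aᵀ * (A * V * Aᵀ)⁻¹ * A).PosSemidef := by
  have hVt : Vᵀ = V := by simpa using hV.isHermitian.eq
  have hVdet : IsUnit V.det := (isUnit_iff_isUnit_det V).1 hV.isUnit
  have hSdet : IsUnit (A * V * Aᵀ).det := (isUnit_iff_isUnit_det _).1 hS
  set W := V⁻¹ - Aᵀ * (A * V * Aᵀ)⁻¹ * A with hW
  have hWt : Wᵀ = W := by
    simp [hW, transpose_nonsing_inv, hVt, Matrix.mul_assoc]
  have hproj : Aᵀ * (A * V * Aᵀ)⁻¹ * A * V * (Aᵀ * (A * V * Aᵀ)⁻¹ * A) =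
      Aᵀ * (A * V * Aᵀ)⁻¹ * A :=
    calc _ = Aᵀ * ((A * V * Aᵀ)⁻¹ * (A * V * Aᵀ)) * (A * V * Aᵀ)⁻¹ * A := by
          simp only [Matrix.mul_assoc]
      _ = _ := by rw [nonsing_inv_mul _ hSdet, Matrix.mul_one]
  have hWVW : Wᵀ * V * W = W := by
    rw [hWt, hW, Matrix.sub_mul, nonsing_inv_mul _ hVdet, Matrix.sub_mul, Matrix.one_mul,
      Matrix.mul_sub, hproj, mul_nonsing_inv_cancel_right _ _ hVdet, sub_self, sub_zero]
  rw [← hWVW]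
  simpa only [conjTranspose_eq_transpose_of_trivial] using
    hV.posSemidef.conjTranspose_mul_mul_same W

/-- information bound in Theorem 6(ii). For `V` symmetric positive
definite and `A` of full row rank, `AVAᵀ` is invertible and
`Γ_θᵀ V⁻¹ Γ_θ − Γ_θᵀ Aᵀ (AVAᵀ)⁻¹ A Γ_θ` is positive semidefinite. -/
theorem stmt10 {q p k : ℕ} (V : Matrix (Fin q) (Fin q) ℝ) (hV : V.PosDef)
    (A : Matrix (Fin p) (Fin q) ℝ) (hA : A.rank = p)
    (Γθ : Matrix (Fin q) (Fin k) ℝ) :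
    IsUnit (A * V * Aᵀ) ∧
    (Γθᵀ * V⁻¹ * Γθ - Γθᵀ * Aᵀ * (A * V * Aᵀ)⁻¹ * A * Γθ).PosSemidef := by
  have hS := (posDef_mul_mul_transpose_of_rank_eq hV (hA.trans (Fintype.card_fin p).symm)).isUnit
  refine ⟨hS, ?_⟩
  have h := (posSemidef_inv_sub_transpose_mul_inv_mul hV hS).conjTranspose_mul_mul_same Γθ
  rw [conjTranspose_eq_transpose_of_trivial, Matrix.mul_sub, Matrix.sub_mul] at h
  simpa only [Matrix.mul_assoc] using h
end

section
/- Let V be a q×q real symmetric positive definite matrix, A a p×q real matrix of full row rank p, and Γ_θ a q×k real matrix of full column rank k such that A Γ_θ also has full column rank k. Then F_A := Γ_θᵀ Aᵀ (A V Aᵀ)⁻¹ A Γ_θ and F := Γ_θᵀ V⁻¹ Γ_θ are both positive definite (hence invertible), and F_A⁻¹ − F⁻¹ is positive semidefinite. -/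
open Matrix

theorem Matrix.mulVec_injective_of_rank_eq_card {m n K : Type*} [Fintype m] [Fintype n] [Field K]
    {M : Matrix m n K} (h : M.rank = Fintype.card n) : Function.Injective M.mulVec := by
  have hker : Module.finrank K (LinearMap.ker M.mulVecLin) = 0 := by
    have hrn := M.mulVecLin.finrank_range_add_finrank_ker
    rw [Module.finrank_fintype_fun_eq_card] at hrn
    rw [Matrix.rank] at h
    omega
  exact LinearMap.ker_eq_bot.mp (Submodule.finrank_eq_zero.mp hker)

/-- Gauss–Markov: among left inverses `B` of `G`, the variance `B V Bᵀ` is minimised in the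
Loewner order by the generalised least squares variance `(Gᵀ V⁻¹ G)⁻¹`. -/
theorem Matrix.PosDef.posSemidef_mul_mul_transpose_sub_inv {n k : Type*} [Fintype n] [Fintype k]
    [DecidableEq n] [DecidableEq k] {V : Matrix n n ℝ} (hV : V.PosDef) {G : Matrix n k ℝ}
    (hF : (Gᵀ * V⁻¹ * G).PosDef) {B : Matrix k n ℝ} (hB : B * G = 1) :
    (B * V * Bᵀ - (Gᵀ * V⁻¹ * G)⁻¹).PosSemidef := by
  set F := Gᵀ * V⁻¹ * G with hFdef
  set C := F⁻¹ * Gᵀ * V⁻¹ with hCdef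
  have hFt : Fᵀ = F := hF.isHermitian.eq
  have hVt : Vᵀ = V := hV.isHermitian.eq
  have hVdet : IsUnit V.det := (isUnit_iff_isUnit_det V).mp hV.isUnit
  have hFdet : IsUnit F.det := (isUnit_iff_isUnit_det F).mp hF.isUnit
  have hCV : C * V = F⁻¹ * Gᵀ := nonsing_inv_mul_cancel_right V _ hVdet
  have hGB : Gᵀ * Bᵀ = 1 := by rw [← transpose_mul, hB, transpose_one]
  have hCG : C * G = 1 := by
    rw [hCdef, Matrix.mul_assoc, Matrix.mul_assoc, ← Matrix.mul_assoc Gᵀ, ← hFdef,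
      nonsing_inv_mul F hFdet]
  have hGC : Gᵀ * Cᵀ = 1 := by rw [← transpose_mul, hCG, transpose_one]
  have hCVB : C * V * Bᵀ = F⁻¹ := by rw [hCV, Matrix.mul_assoc, hGB, Matrix.mul_one]
  have hCVC : C * V * Cᵀ = F⁻¹ := by rw [hCV, Matrix.mul_assoc, hGC, Matrix.mul_one]
  have hBVC : B * V * Cᵀ = F⁻¹ := by
    have h := congrArg Matrix.transpose hCVB
    rwa [transpose_mul, transpose_mul, transpose_transpose, hVt, ← Matrix.mul_assoc,
      transpose_nonsing_inv, hFt] at h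
  have hsub : B * V * Bᵀ - F⁻¹ = (B - C) * V * (B - C)ᵀ := by
    rw [transpose_sub, Matrix.sub_mul, Matrix.sub_mul, Matrix.mul_sub, Matrix.mul_sub,
      hCVB, hCVC, hBVC, sub_self, sub_zero]
  rw [hsub]
  exact hV.posSemidef.mul_mul_conjTranspose_same (B - C)

/-- variance form of Theorem 6(ii). For `V` symmetric positive
definite, `A` of full row rank `p`, `Γ_θ` of full column rank `k` with `AΓ_θ` also of
full column rank, both `F_A = Γ_θᵀAᵀ(AVAᵀ)⁻¹AΓ_θ` and `F = Γ_θᵀV⁻¹Γ_θ` are positive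
definite (hence invertible) and `F_A⁻¹ − F⁻¹` is positive semidefinite. -/
theorem stmt12 {q p k : ℕ} (V : Matrix (Fin q) (Fin q) ℝ) (hV : V.PosDef)
    (A : Matrix (Fin p) (Fin q) ℝ) (hA : A.rank = p)
    (Γθ : Matrix (Fin q) (Fin k) ℝ) (hΓθ : Γθ.rank = k)
    (hAΓθ : (A * Γθ).rank = k) :
    let FA : Matrix (Fin k) (Fin k) ℝ := Γθᵀ * Aᵀ * (A * V * Aᵀ)⁻¹ * A * Γθ
    let F : Matrix (Fin k) (Fin k) ℝ := Γθᵀ * V⁻¹ * Γθ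
    FA.PosDef ∧ F.PosDef ∧ IsUnit FA ∧ IsUnit F ∧ (FA⁻¹ - F⁻¹).PosSemidef := by
  intro FA F
  have hS : (A * V * Aᵀ).PosDef := by
    have h := hV.conjTranspose_mul_mul_same (B := Aᵀ)
      (mulVec_injective_of_rank_eq_card (by rw [rank_transpose, hA, Fintype.card_fin]))
    rwa [conjTranspose_eq_transpose_of_trivial, transpose_transpose] at h
  have hF : F.PosDef := hV.inv.conjTranspose_mul_mul_same
    (mulVec_injective_of_rank_eq_card (by rw [hΓθ, Fintype.card_fin]))
  have hFA : FA.PosDef := by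
    have h := hS.inv.conjTranspose_mul_mul_same (B := A * Γθ)
      (mulVec_injective_of_rank_eq_card (by rw [hAΓθ, Fintype.card_fin]))
    rwa [conjTranspose_eq_transpose_of_trivial, transpose_mul, ← Matrix.mul_assoc] at h
  refine ⟨hFA, hF, hFA.isUnit, hF.isUnit, ?_⟩
  have hFAdet : IsUnit FA.det := (isUnit_iff_isUnit_det FA).mp hFA.isUnit
  have hSdet : IsUnit (A * V * Aᵀ).det := (isUnit_iff_isUnit_det _).mp hS.isUnit
  have hFAt : FAᵀ = FA := hFA.isHermitian.eq
  have hSt : (A * V * Aᵀ)ᵀ = A * V * Aᵀ := hS.isHermitian.eq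
  set B := FA⁻¹ * (Γθᵀ * Aᵀ * (A * V * Aᵀ)⁻¹ * A) with hBdef
  have hB : B * Γθ = 1 := by
    rw [hBdef, Matrix.mul_assoc]
    exact nonsing_inv_mul FA hFAdet
  have hBt : Bᵀ = Aᵀ * (A * V * Aᵀ)⁻¹ * (A * Γθ) * FA⁻¹ := by
    rw [hBdef, transpose_mul, transpose_mul, transpose_mul, transpose_mul, transpose_nonsing_inv,
      transpose_nonsing_inv, hSt, hFAt, transpose_transpose, transpose_transpose]
    simp only [Matrix.mul_assoc]
  have hBVB : B * V * Bᵀ = FA⁻¹ := by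
    calc B * V * Bᵀ
        = FA⁻¹ * (Γθᵀ * Aᵀ * ((A * V * Aᵀ)⁻¹ * (A * V * Aᵀ)) * (A * V * Aᵀ)⁻¹ * A * Γθ) * FA⁻¹ := by
          rw [hBt, hBdef]
          simp only [Matrix.mul_assoc]
      _ = FA⁻¹ * FA * FA⁻¹ := by rw [nonsing_inv_mul _ hSdet, Matrix.mul_one]
      _ = FA⁻¹ := by rw [nonsing_inv_mul FA hFAdet, Matrix.one_mul]
  rw [← hBVB]
  exact hV.posSemidef_mul_mul_transpose_sub_inv hF hB
end

section
/- Let V be a q×q real symmetric positive definite matrix, Γ a q×p real matrix such that Γᵀ V⁻¹ Γ is invertible, B a p×k real matrix, and Γ_θ = −Γ B. Then for the selection matrix A = Γᵀ V⁻¹ (the optimal choice for direct estimation of the auxiliary parameters), A V Aᵀ = Γᵀ V⁻¹ Γ is invertible and Γ_θᵀ Aᵀ (A V Aᵀ)⁻¹ A Γ_θ = Γ_θᵀ V⁻¹ Γ_θ. -/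
open Matrix

/-- no conflict when restrictions hold along the binding function.
If `Γ_θ = −ΓB`, then for the selection matrix `A = ΓᵀV⁻¹` (optimal for direct
estimation of the auxiliary parameters) one has `AVAᵀ = ΓᵀV⁻¹Γ` invertible and
`Γ_θᵀAᵀ(AVAᵀ)⁻¹AΓ_θ = Γ_θᵀV⁻¹Γ_θ`. -/
theorem stmt13 {q p k : ℕ} (V : Matrix (Fin q) (Fin q) ℝ) (hV : V.PosDef)
    (Γ : Matrix (Fin q) (Fin p) ℝ) (hΓ : IsUnit (Γᵀ * V⁻¹ * Γ))
    (B : Matrix (Fin p) (Fin k) ℝ) :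
    let Γθ : Matrix (Fin q) (Fin k) ℝ := -(Γ * B)
    let A : Matrix (Fin p) (Fin q) ℝ := Γᵀ * V⁻¹
    A * V * Aᵀ = Γᵀ * V⁻¹ * Γ ∧ IsUnit (A * V * Aᵀ) ∧
    Γθᵀ * Aᵀ * (A * V * Aᵀ)⁻¹ * A * Γθ = Γθᵀ * V⁻¹ * Γθ := by
  intro Γθ A
  have hdet : IsUnit V.det := (isUnit_iff_isUnit_det V).mp hV.isUnit
  have hVt : Vᵀ = V := by simpa using hV.isHermitian.eq
  have hAt : Aᵀ = V⁻¹ * Γ := by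
    simp only [A, transpose_mul, transpose_transpose, transpose_nonsing_inv, hVt]
  have hAVA : A * V * Aᵀ = Γᵀ * V⁻¹ * Γ := by
    rw [hAt, ← Matrix.mul_assoc, Matrix.mul_assoc A V, mul_nonsing_inv V hdet, Matrix.mul_one]
  refine ⟨hAVA, hAVA ▸ hΓ, ?_⟩
  have hAΓ : A * Γθ = -(Γᵀ * V⁻¹ * Γ * B) := by
    simp only [A, Γθ, Matrix.mul_neg, Matrix.mul_assoc]
  have hcancel : (Γᵀ * V⁻¹ * Γ)⁻¹ * (A * Γθ) = -B := by
    rw [hAΓ, Matrix.mul_neg,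
      nonsing_inv_mul_cancel_left _ _ ((isUnit_iff_isUnit_det _).mp hΓ)]
  calc Γθᵀ * Aᵀ * (A * V * Aᵀ)⁻¹ * A * Γθ
      = Γθᵀ * Aᵀ * ((Γᵀ * V⁻¹ * Γ)⁻¹ * (A * Γθ)) := by
        rw [hAVA]; simp only [Matrix.mul_assoc]
    _ = Γθᵀ * V⁻¹ * Γθ := by
        rw [hcancel, hAt]; simp only [Γθ, Matrix.mul_neg, Matrix.mul_assoc]
end

section
/- Let D be a p×k real matrix of full column rank (k ≤ p), and let J, I₀, W be p×p real symmetric positive definite matrices. Define A(W) = Dᵀ J⁻¹ W J⁻¹ D, B(W) = Dᵀ J⁻¹ W J⁻¹ I₀ J⁻¹ W J⁻¹ D, and Ω(W) = A(W)⁻¹ B(W) A(W)⁻¹. Then A(W) and Dᵀ I₀⁻¹ D are positive definite (hence invertible), the matrix Ω(W) − (Dᵀ I₀⁻¹ D)⁻¹ is positive semidefinite for every such W, and for W* = J I₀⁻¹ J one has Ω(W*) = (Dᵀ I₀⁻¹ D)⁻¹. -/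
open Matrix

namespace Matrix

theorem mulVec_injective_of_rank_eq_card_s14 {m n K : Type*} [Fintype n] [Field K]
    {D : Matrix m n K} (hD : D.rank = Fintype.card n) : Function.Injective D.mulVec := by
  have h := D.mulVecLin.finrank_range_add_finrank_ker
  rw [Module.finrank_fintype_fun_eq_card] at h
  have hker : Module.finrank K (LinearMap.ker D.mulVecLin) = 0 := by
    unfold rank at hD
    omega
  exact LinearMap.ker_eq_bot.mp (Submodule.finrank_eq_zero.mp hker)

variable {m n : Type*} [Fintype m] [Fintype n]

theorem PosDef.transpose_mul_mul_same {V : Matrix m m ℝ} {D : Matrix m n ℝ} (hV : V.PosDef)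
    (hD : Function.Injective D.mulVec) : (Dᵀ * V * D).PosDef := by
  simpa using hV.conjTranspose_mul_mul_same hD

variable [DecidableEq m] [DecidableEq n]

/-- The sandwich matrix minus the inverse information matrix is a congruence transform of `S`. -/
theorem sandwich_sub_inv_eq {D : Matrix m n ℝ} {S V : Matrix m m ℝ} (hS : S.PosDef)
    (hV : V.PosDef) (hD : Function.Injective D.mulVec) :
    (Dᵀ * V * D)⁻¹ * (Dᵀ * V * S * V * D) * (Dᵀ * V * D)⁻¹ - (Dᵀ * S⁻¹ * D)⁻¹ =
      (V * D * (Dᵀ * V * D)⁻¹ - S⁻¹ * D * (Dᵀ * S⁻¹ * D)⁻¹)ᵀ * S *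
        (V * D * (Dᵀ * V * D)⁻¹ - S⁻¹ * D * (Dᵀ * S⁻¹ * D)⁻¹) := by
  have hA := hV.transpose_mul_mul_same hD
  have hG := hS.inv.transpose_mul_mul_same hD
  have hVt : Vᵀ = V := by simpa using hV.isHermitian.eq
  have hSt : S⁻¹ᵀ = S⁻¹ := by simpa using hS.inv.isHermitian.eq
  have hAt : (Dᵀ * V * D)⁻¹ᵀ = (Dᵀ * V * D)⁻¹ := by simpa using hA.inv.isHermitian.eq
  have hGt : (Dᵀ * S⁻¹ * D)⁻¹ᵀ = (Dᵀ * S⁻¹ * D)⁻¹ := by simpa using hG.inv.isHermitian.eq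
  have hSu := (isUnit_iff_isUnit_det S).mp hS.isUnit
  have hA₁ := nonsing_inv_mul _ ((isUnit_iff_isUnit_det _).mp hA.isUnit)
  have hA₂ := mul_nonsing_inv _ ((isUnit_iff_isUnit_det _).mp hA.isUnit)
  have hG₂ := mul_nonsing_inv _ ((isUnit_iff_isUnit_det _).mp hG.isUnit)
  simp only [transpose_sub, transpose_mul, hVt, hSt, hAt, hGt]
  generalize (Dᵀ * V * D)⁻¹ = P at *
  generalize (Dᵀ * S⁻¹ * D)⁻¹ = Q at *
  simp only [Matrix.mul_assoc] at hA₁ hA₂ hG₂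
  have hPQ : P * (Dᵀ * (V * (D * Q))) = Q := by
    simpa only [Matrix.mul_assoc, Matrix.one_mul] using congrArg (· * Q) hA₁
  simp only [Matrix.mul_sub, Matrix.sub_mul, Matrix.mul_assoc, mul_nonsing_inv_cancel_left _ _ hSu,
    nonsing_inv_mul_cancel_left _ _ hSu, hPQ, hA₂, hG₂, Matrix.mul_one]
  abel

end Matrix

/-- optimal weighting, Theorem 2 of the paper. With
`A(W) = DᵀJ⁻¹WJ⁻¹D`, `B(W) = DᵀJ⁻¹WJ⁻¹I₀J⁻¹WJ⁻¹D`, `Ω(W) = A(W)⁻¹B(W)A(W)⁻¹`: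
for every symmetric positive definite `W`, `A(W)` and `DᵀI₀⁻¹D` are positive definite
and `Ω(W) − (DᵀI₀⁻¹D)⁻¹` is positive semidefinite; for `W* = JI₀⁻¹J`,
`Ω(W*) = (DᵀI₀⁻¹D)⁻¹`. -/
theorem stmt14 {p k : ℕ} (D : Matrix (Fin p) (Fin k) ℝ) (hD : D.rank = k)
    (J I₀ : Matrix (Fin p) (Fin p) ℝ) (hJ : J.PosDef) (hI₀ : I₀.PosDef) :
    let A : Matrix (Fin p) (Fin p) ℝ → Matrix (Fin k) (Fin k) ℝ :=
      fun W => Dᵀ * J⁻¹ * W * J⁻¹ * D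
    let B : Matrix (Fin p) (Fin p) ℝ → Matrix (Fin k) (Fin k) ℝ :=
      fun W => Dᵀ * J⁻¹ * W * J⁻¹ * I₀ * J⁻¹ * W * J⁻¹ * D
    let Om : Matrix (Fin p) (Fin p) ℝ → Matrix (Fin k) (Fin k) ℝ :=
      fun W => (A W)⁻¹ * B W * (A W)⁻¹
    (Dᵀ * I₀⁻¹ * D).PosDef ∧
    (∀ W : Matrix (Fin p) (Fin p) ℝ, W.PosDef →
      (A W).PosDef ∧ (Om W - (Dᵀ * I₀⁻¹ * D)⁻¹).PosSemidef) ∧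
    Om (J * I₀⁻¹ * J) = (Dᵀ * I₀⁻¹ * D)⁻¹ := by
  intro A B Om
  have hDinj : Function.Injective D.mulVec := mulVec_injective_of_rank_eq_card_s14 (by simpa using hD)
  have hG := hI₀.inv.transpose_mul_mul_same hDinj
  have hJt : J⁻¹ᵀ = J⁻¹ := by simpa using hJ.inv.isHermitian.eq
  have hJu := (isUnit_iff_isUnit_det J).mp hJ.isUnit
  have hIu := (isUnit_iff_isUnit_det I₀).mp hI₀.isUnit
  have hGu := (isUnit_iff_isUnit_det _).mp hG.isUnit
  have hJinj : Function.Injective J⁻¹.mulVec := mulVec_injective_iff_isUnit.mpr hJ.inv.isUnit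
  have hA (W) : A W = Dᵀ * (J⁻¹ * W * J⁻¹) * D := by simp only [A, Matrix.mul_assoc]
  have hB (W) : B W = Dᵀ * (J⁻¹ * W * J⁻¹) * I₀ * (J⁻¹ * W * J⁻¹) * D := by
    simp only [B, Matrix.mul_assoc]
  refine ⟨hG, fun W hW => ?_, ?_⟩
  · have hV : (J⁻¹ * W * J⁻¹).PosDef := by
      simpa only [hJt] using hW.transpose_mul_mul_same hJinj
    refine ⟨hA W ▸ hV.transpose_mul_mul_same hDinj, ?_⟩
    simp only [Om, hA, hB]
    rw [sandwich_sub_inv_eq hI₀ hV hDinj]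
    simpa only [conjTranspose_eq_transpose_of_trivial] using
      hI₀.posSemidef.conjTranspose_mul_mul_same _
  · have hV : J⁻¹ * (J * I₀⁻¹ * J) * J⁻¹ = I₀⁻¹ := by
      simp only [Matrix.mul_assoc, mul_nonsing_inv _ hJu, Matrix.mul_one,
        nonsing_inv_mul_cancel_left _ _ hJu]
    simp only [Om, hA, hB, hV]
    rw [nonsing_inv_mul_cancel_right _ _ hIu, nonsing_inv_mul _ hGu, Matrix.one_mul]
end
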